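/- arXiv:1308.6348 — 2 statements merged into one kernel-verified Lean document; each statement's English description precedes it below -/
import Mathlib

section
/- Let R be an incline and x a regular element of R. For any y in R, both x*y and y*x are regular if and only if x*y = y*x*y and y*x*y = y*x. -/
/-- An incline: a nonempty set with `+` and `*` such that `(R,+)` is a commutative
semigroup, `(R,*)` is a semigroup, `*` distributes over `+` from both sides,
addition is idempotent, and `x + x*y = x`, `x + y*x = x` for all `x y`.
(Nonemptiness is assumed via `Nonempty R` where needed.) -/
class Incline (R : Type*) extends Add R, Mul R where
  add_comm : ∀ x y : R, x + y = y + x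
  add_assoc : ∀ x y z : R, x + y + z = x + (y + z)
  mul_assoc : ∀ x y z : R, x * y * z = x * (y * z)
  left_distrib : ∀ x y z : R, x * (y + z) = x * y + x * z
  right_distrib : ∀ x y z : R, (x + y) * z = x * z + y * z
  add_idem : ∀ x : R, x + x = x
  add_absorb_mul_left : ∀ x y : R, x + x * y = x
  add_absorb_mul_right : ∀ x y : R, x + y * x = x

/-- An element `a` of an incline is regular if `a * z * a = a` for some `z`. -/
def Incline.IsRegular {R : Type*} [Incline R] (a : R) : Prop :=
  ∃ z : R, a * z * a = a

namespace Incline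

variable {R : Type*} [Incline R]

theorem eq_of_add_eq {a b : R} (hab : a + b = b) (hba : b + a = a) : a = b := by
  rw [← hba, add_comm, hab]

theorem IsRegular.mul_self {a : R} (ha : IsRegular a) : a * a = a := by
  obtain ⟨z, hz⟩ := ha
  have haz : a * z = a := by
    refine eq_of_add_eq ?_ ?_
    · rw [add_comm, add_absorb_mul_left]
    · have h := add_absorb_mul_left (a * z) a
      rwa [hz, add_comm] at h
  rwa [haz] at hz

theorem isRegular_of_mul_self {a : R} (ha : a * a = a) : IsRegular a :=
  ⟨a, by rw [ha, ha]⟩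

theorem mul_eq_mul_mul_of_isRegular {x y : R} (h : IsRegular (x * y)) :
    x * y = y * x * y := by
  refine eq_of_add_eq ?_ ?_
  · have h' := add_absorb_mul_right (y * x * y) x
    rwa [mul_assoc y, ← mul_assoc x y, h.mul_self, add_comm, ← mul_assoc] at h'
  · rw [mul_assoc, add_comm, add_absorb_mul_right]

theorem mul_mul_eq_mul_of_isRegular {x y : R} (h : IsRegular (y * x)) :
    y * x * y = y * x := by
  refine eq_of_add_eq ?_ ?_
  · rw [add_comm, add_absorb_mul_left]
  · have h' := add_absorb_mul_left (y * x * y) x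
    rwa [mul_assoc (y * x), h.mul_self, add_comm] at h'

end Incline

theorem incline_mul_both_regular_iff {R : Type*} [Incline R] (x : R)
    (hx : Incline.IsRegular x) (y : R) :
    (Incline.IsRegular (x * y) ∧ Incline.IsRegular (y * x)) ↔
      (x * y = y * x * y ∧ y * x * y = y * x) := by
  constructor
  · rintro ⟨hxy, hyx⟩
    exact ⟨Incline.mul_eq_mul_mul_of_isRegular hxy, Incline.mul_mul_eq_mul_of_isRegular hyx⟩
  · rintro ⟨hxy, hyx⟩
    have hreg : Incline.IsRegular (x * y) := by
      apply Incline.isRegular_of_mul_self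
      rw [Incline.mul_assoc, ← Incline.mul_assoc y, ← hxy, ← Incline.mul_assoc, hx.mul_self]
    exact ⟨hreg, hxy.trans hyx ▸ hreg⟩
end

section
/- Let R be an incline and x, y two regular elements of R with x*y = y*x. Then x*y is regular; in fact (x*y)*(x*y) = x*y. -/
/-- Every regular element of an incline is multiplicatively idempotent. -/
theorem Incline.IsRegular.mul_self_s7 {R : Type*} [Incline R] {a : R}
    (ha : Incline.IsRegular a) : a * a = a := by
  obtain ⟨z, hz⟩ := ha
  have h : a * z = a := by
    have h₁ := Incline.add_absorb_mul_left (a * z) a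
    rw [hz, Incline.add_comm, Incline.add_absorb_mul_left] at h₁
    exact h₁.symm
  rwa [h] at hz

theorem incline_mul_regular_of_comm {R : Type*} [Incline R] (x y : R)
    (hx : Incline.IsRegular x) (hy : Incline.IsRegular y) (hcomm : x * y = y * x) :
    Incline.IsRegular (x * y) ∧ (x * y) * (x * y) = x * y := by
  have h : (x * y) * (x * y) = x * y := by
    calc (x * y) * (x * y) = x * (y * x) * y := by simp only [Incline.mul_assoc]
      _ = x * (x * y) * y := by rw [hcomm]
      _ = (x * x) * (y * y) := by simp only [Incline.mul_assoc]
      _ = x * y := by rw [hx.mul_self_s7, hy.mul_self_s7]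
  exact ⟨⟨x * y, by rw [h, h]⟩, h⟩
end
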